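/- For every analytic set A ⊆ 2^ℕ × [ω]^ω, the set {x ∈ 2^ℕ : the section A_x = {a ∈ [ω]^ω : (x,a) ∈ A} is Ramsey positive} is a Σ¹₂ subset of 2^ℕ. -/

import Mathlib

open MeasureTheory TopologicalSpace

/-- The space `[ω]^ω` of infinite subsets of `ℕ`, topologized as a subspace of the
Cantor space `ℕ → Bool` via characteristic functions. -/
abbrev IOI := {x : ℕ → Bool // {n | x n = true}.Infinite}

/-- A set is `Σ¹₂` if it is the image of a coanalytic subset of Baire space under a
continuous map. -/
def Sigma12 {X : Type*} [TopologicalSpace X] (A : Set X) : Prop :=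
  ∃ (C : Set (ℕ → ℕ)) (f : (ℕ → ℕ) → X),
    MeasureTheory.AnalyticSet Cᶜ ∧ Continuous f ∧ f '' C = A

/-- A topological space is zero-dimensional if it has a basis of clopen sets. -/
def ZeroDim (X : Type*) [TopologicalSpace X] : Prop :=
  ∃ b : Set (Set X), (∀ s ∈ b, IsClopen s) ∧ TopologicalSpace.IsTopologicalBasis b

/-- `A` is `Σ¹₂`-complete: `A` is `Σ¹₂` and every `Σ¹₂` subset of a zero-dimensional
Polish space is a continuous preimage of `A`. -/
def Sigma12Complete {X : Type*} [TopologicalSpace X] (A : Set X) : Prop :=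
  Sigma12 A ∧
  ∀ (Z : Type) [TopologicalSpace Z] [PolishSpace Z], ZeroDim Z →
    ∀ B : Set Z, Sigma12 B → ∃ f : Z → X, Continuous f ∧ f ⁻¹' A = B

/-- The Ellentuck basic set `[σ,s]`: all infinite `a ⊆ ℕ` with `a ∩ {0,…,max σ} = σ`
and every element of `a` greater than `max σ` lying in `s` (stated max-free:
`σ ⊆ a`, and every element of `a` outside `σ` lies in `s` and is above all of `σ`). -/
def ES (σ : Finset ℕ) (s : Set ℕ) : Set IOI :=
  {a | (∀ m ∈ σ, a.1 m = true) ∧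
       ∀ n, a.1 n = true → n ∉ σ → n ∈ s ∧ ∀ m ∈ σ, m < n}

/-- A legitimate Ellentuck pair: `s` is infinite and `max σ < min s`. -/
def GoodPair (σ : Finset ℕ) (s : Set ℕ) : Prop :=
  s.Infinite ∧ ∀ m ∈ σ, ∀ n ∈ s, m < n

/-- `A ⊆ [ω]^ω` is Ramsey null if every Ellentuck basic set `[σ,s]` can be shrunk to
`[σ,s']` (with `s' ⊆ s` infinite, `min s' > max σ`) disjoint from `A`. -/
def RamseyNull (A : Set IOI) : Prop :=
  ∀ σ : Finset ℕ, ∀ s : Set ℕ, GoodPair σ s →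
    ∃ s' ⊆ s, s'.Infinite ∧ (∀ m ∈ σ, ∀ n ∈ s', m < n) ∧ ES σ s' ∩ A = ∅

/-- `A` is Ramsey positive if it is not Ramsey null. -/
def RamseyPositive (A : Set IOI) : Prop := ¬ RamseyNull A

/-- The part of `s` lying strictly above the finite set `τ`. -/
def tailAbove (τ : Finset ℕ) (s : Set ℕ) : Set ℕ := {n ∈ s | ∀ m ∈ τ, m < n}

theorem tailAbove_subset (τ : Finset ℕ) (s : Set ℕ) : tailAbove τ s ⊆ s := fun _ h => h.1

theorem tailAbove_mono {τ : Finset ℕ} {s t : Set ℕ} (h : s ⊆ t) :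
    tailAbove τ s ⊆ tailAbove τ t := fun _ hn => ⟨h hn.1, hn.2⟩

theorem tailAbove_anti {τ τ' : Finset ℕ} (s : Set ℕ) (h : τ ⊆ τ') :
    tailAbove τ' s ⊆ tailAbove τ s := fun _ hn => ⟨hn.1, fun m hm => hn.2 m (h hm)⟩

theorem Set.Infinite.tailAbove {s : Set ℕ} (hs : s.Infinite) (τ : Finset ℕ) :
    (tailAbove τ s).Infinite := by
  refine (hs.sdiff (Set.finite_Iic (τ.sup id))).mono fun n hn => ⟨hn.1, fun m hm => ?_⟩
  have h1 : m ≤ τ.sup id := Finset.le_sup (f := id) hm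
  have h2 : ¬ n ≤ τ.sup id := hn.2
  omega

theorem ES_subset_of_tailAbove {τ : Finset ℕ} {s s' : Set ℕ} (h : tailAbove τ s' ⊆ s) :
    ES τ s' ⊆ ES τ s := fun _ ha =>
  ⟨ha.1, fun n hn hnτ => ⟨h ⟨(ha.2 n hn hnτ).1, (ha.2 n hn hnτ).2⟩, (ha.2 n hn hnτ).2⟩⟩

theorem ES_mono (τ : Finset ℕ) {s s' : Set ℕ} (h : s' ⊆ s) : ES τ s' ⊆ ES τ s :=
  ES_subset_of_tailAbove ((tailAbove_subset _ _).trans h)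

theorem coe_subset_of_mem_ES {τ τ' : Finset ℕ} {s : Set ℕ} {a : IOI} (ha : a ∈ ES τ s)
    (ha' : a ∈ ES τ' Set.univ) : (τ' : Set ℕ) ⊆ ↑τ ∪ s := fun n hn => by
  by_cases h : n ∈ τ
  · exact Or.inl h
  · exact Or.inr (ha.2 n (ha'.1 n hn) h).1

theorem exists_mem_ES_insert {τ : Finset ℕ} {s : Set ℕ} {a : IOI} (ha : a ∈ ES τ s) :
    ∃ m ∈ s, (∀ k ∈ τ, k < m) ∧ a ∈ ES (insert m τ) s := by
  classical
  have hne : ∃ n, a.1 n = true ∧ n ∉ τ := by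
    obtain ⟨n, hn⟩ := (a.2.sdiff τ.finite_toSet).nonempty
    exact ⟨n, hn.1, hn.2⟩
  obtain ⟨h1, h2⟩ := Nat.find_spec hne
  have hmin := fun k => Nat.find_min' hne (m := k)
  set m := Nat.find hne
  refine ⟨m, (ha.2 m h1 h2).1, (ha.2 m h1 h2).2, ?_, ?_⟩
  · intro k hk
    rcases Finset.mem_insert.1 hk with rfl | hk
    · exact h1
    · exact ha.1 k hk
  · intro n hn hnm
    rw [Finset.mem_insert, not_or] at hnm
    refine ⟨(ha.2 n hn hnm.2).1, fun k hk => ?_⟩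
    rcases Finset.mem_insert.1 hk with rfl | hk
    · exact lt_of_le_of_ne (hmin n ⟨hn, hnm.2⟩) (Ne.symm hnm.1)
    · exact (ha.2 n hn hnm.2).2 k hk

theorem exists_card_le_mem_ES {τ : Finset ℕ} {s : Set ℕ} {a : IOI} (ha : a ∈ ES τ s) (N : ℕ) :
    ∃ τ', τ ⊆ τ' ∧ N ≤ τ'.card ∧ a ∈ ES τ' s := by
  induction N with
  | zero => exact ⟨τ, subset_rfl, Nat.zero_le _, ha⟩
  | succ N ih =>
    obtain ⟨τ', h1, h2, h3⟩ := ih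
    obtain ⟨m, -, hm, h⟩ := exists_mem_ES_insert h3
    have : m ∉ τ' := fun hmem => lt_irrefl _ (hm m hmem)
    exact ⟨insert m τ', h1.trans (Finset.subset_insert _ _),
      by rw [Finset.card_insert_of_notMem this]; omega, h⟩

theorem subset_of_mem_ES_of_card_le {τ τ' : Finset ℕ} {a : IOI} (ha : a ∈ ES τ Set.univ)
    (ha' : a ∈ ES τ' Set.univ) (h : τ'.card ≤ τ.card) : τ' ⊆ τ := by
  intro k hk
  by_contra hkτ
  have hlt := (ha.2 k (ha'.1 k hk) hkτ).2
  have hsub : τ ⊂ τ' := by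
    refine (Finset.ssubset_iff_of_subset fun m hm => ?_).2 ⟨k, hk, hkτ⟩
    by_contra hmτ'
    exact lt_asymm (hlt m hm) ((ha'.2 m (ha.1 m hm) hmτ').2 k hk)
  exact absurd (Finset.card_lt_card hsub) (by omega)

theorem mem_ES_of_subset {τ τ' : Finset ℕ} {s : Set ℕ} {a : IOI} (ha : a ∈ ES τ s)
    (ha' : a ∈ ES τ' Set.univ) (h : τ ⊆ τ') : a ∈ ES τ' s :=
  ⟨ha'.1, fun n hn hnτ => ⟨(ha.2 n hn fun hm => hnτ (h hm)).1, (ha'.2 n hn hnτ).2⟩⟩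

theorem mem_ES_of_initial {τ τ' : Finset ℕ} {a b : IOI} (ha : a ∈ ES τ Set.univ)
    (ha' : a ∈ ES τ' Set.univ) (h : τ' ⊆ τ) (hb : b ∈ ES τ Set.univ) : b ∈ ES τ' Set.univ :=
  ⟨fun m hm => hb.1 m (h hm), fun n hn hnτ' => ⟨trivial, fun m hm => by
    by_cases hnτ : n ∈ τ
    · exact (ha'.2 n (ha.1 n hnτ) hnτ').2 m hm
    · exact (hb.2 n hn hnτ).2 m (h hm)⟩⟩

theorem exists_infinite_subset_forall_finset {ι : Type*} (Q : ι → Set ℕ → Prop) (s₀ : Set ℕ)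
    (mono : ∀ i s s', s' ⊆ s → Q i s → Q i s') (t : Finset ι)
    (dense : ∀ i ∈ t, ∀ s ⊆ s₀, s.Infinite → ∃ s' ⊆ s, s'.Infinite ∧ Q i s')
    (s : Set ℕ) (hs : s ⊆ s₀) (hsi : s.Infinite) :
    ∃ s' ⊆ s, s'.Infinite ∧ ∀ i ∈ t, Q i s' := by
  classical
  induction t using Finset.induction_on with
  | empty => exact ⟨s, subset_rfl, hsi, by simp⟩
  | insert i t _ ih =>
    obtain ⟨s₁, h1, h2, h3⟩ := ih fun j hj => dense j (Finset.mem_insert_of_mem hj)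
    obtain ⟨s₂, h4, h5, h6⟩ := dense i (Finset.mem_insert_self _ _) s₁ (h1.trans hs) h2
    refine ⟨s₂, h4.trans h1, h5, fun j hj => ?_⟩
    rcases Finset.mem_insert.1 hj with rfl | hj
    · exact h6
    · exact mono j _ _ h4 (h3 j hj)

/-- Fusion: a hereditary dense property of pairs `(τ, s)` holds simultaneously for all finite
subsets `τ` of `σ ∪ s`, for some infinite `s ⊆ s₀`. -/
theorem exists_fusion (P : Finset ℕ → Set ℕ → Prop) (σ : Finset ℕ) (s₀ : Set ℕ)
    (h₀ : s₀.Infinite)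
    (hered : ∀ τ s s', tailAbove τ s' ⊆ s → P τ s → P τ s')
    (dense : ∀ τ : Finset ℕ, (τ : Set ℕ) ⊆ ↑σ ∪ s₀ → ∀ s ⊆ s₀, s.Infinite →
      ∃ s' ⊆ s, s'.Infinite ∧ P τ s') :
    ∃ s ⊆ s₀, s.Infinite ∧ ∀ τ : Finset ℕ, (τ : Set ℕ) ⊆ ↑σ ∪ s → P τ s := by
  classical
  have refine_all : ∀ F : Finset ℕ, (F : Set ℕ) ⊆ ↑σ ∪ s₀ → ∀ s ⊆ s₀, s.Infinite →
      ∃ s' ⊆ s, s'.Infinite ∧ ∀ τ ⊆ F, P τ s' := by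
    intro F hF s hs hsi
    obtain ⟨s', h1, h2, h3⟩ := exists_infinite_subset_forall_finset P s₀
      (fun τ s s' h => hered τ s s' ((tailAbove_subset _ _).trans h)) F.powerset
      (fun τ hτ => dense τ ((Finset.coe_subset.2 (Finset.mem_powerset.1 hτ)).trans hF)) s hs hsi
    exact ⟨s', h1, h2, fun τ hτ => h3 τ (Finset.mem_powerset.2 hτ)⟩
  let S := {p : Finset ℕ × Set ℕ // (p.1 : Set ℕ) ⊆ ↑σ ∪ s₀ ∧ p.2 ⊆ s₀ ∧ p.2.Infinite ∧
    ∀ τ ⊆ p.1, P τ p.2}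
  have step : ∀ p : S, ∃ (q : S) (n : ℕ), n ∈ p.1.2 ∧ (∀ m ∈ p.1.1, m < n) ∧
      q.1.1 = insert n p.1.1 ∧ q.1.2 ⊆ p.1.2 := by
    rintro ⟨⟨F, s⟩, hF, hs, hsi, -⟩
    obtain ⟨n, hn⟩ := (hsi.tailAbove F).nonempty
    have hF' : ((insert n F : Finset ℕ) : Set ℕ) ⊆ ↑σ ∪ s₀ := by
      rw [Finset.coe_insert]
      exact Set.insert_subset (Or.inr (hs hn.1)) hF
    obtain ⟨s', h1, h2, h3⟩ := refine_all (insert n F) hF' s hs hsi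
    exact ⟨⟨⟨insert n F, s'⟩, hF', h1.trans hs, h2, h3⟩, n, hn.1, hn.2, rfl, h1⟩
  choose next elt helt hlt hins hsub using step
  obtain ⟨s₁, h1, h2, h3⟩ := refine_all σ Set.subset_union_left s₀ subset_rfl h₀
  let q : ℕ → S := fun i => next^[i] ⟨⟨σ, s₁⟩, Set.subset_union_left, h1, h2, h3⟩
  have hq : ∀ i, q (i + 1) = next (q i) := fun i => Function.iterate_succ_apply' _ _ _
  let n : ℕ → ℕ := fun i => elt (q i)
  have hF : ∀ i, (q (i + 1)).1.1 = insert (n i) (q i).1.1 := fun i => by rw [hq, hins]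
  have hFmono : Monotone fun i => (q i).1.1 := monotone_nat_of_le_succ fun i => by
    rw [hF]; exact Finset.subset_insert _ _
  have hanti : Antitone fun i => (q i).1.2 := antitone_nat_of_succ_le fun i => by
    change (q (i + 1)).1.2 ⊆ (q i).1.2
    rw [hq]; exact hsub _
  have hnmem : ∀ i, n i ∈ (q (i + 1)).1.1 := fun i => by rw [hF]; exact Finset.mem_insert_self _ _
  have hn : StrictMono n := strictMono_nat_of_lt_succ fun i => hlt (q (i + 1)) _ (hnmem i)
  have hmem : ∀ i j, i ≤ j → n j ∈ (q i).1.2 := fun i j hij => hanti hij (helt (q j))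
  refine ⟨Set.range n, ?_, Set.infinite_range_of_injective hn.injective, fun τ hτ => ?_⟩
  · rintro _ ⟨i, rfl⟩
    exact (q i).2.2.1 (helt _)
  have hex : ∃ i, τ ⊆ (q i).1.1 := by
    refine ⟨τ.sup id + 1, fun k hk => ?_⟩
    rcases hτ hk with hkσ | ⟨j, rfl⟩
    · exact hFmono (Nat.zero_le _) hkσ
    · have h4 : n j ≤ τ.sup id := Finset.le_sup (f := id) hk
      exact hFmono (Nat.succ_le_succ ((hn.id_le j).trans h4)) (hnmem j)
  obtain ⟨i, hi, hmin⟩ : ∃ i, τ ⊆ (q i).1.1 ∧ ∀ j < i, ¬ τ ⊆ (q j).1.1 :=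
    ⟨Nat.find hex, Nat.find_spec hex, fun j hj => Nat.find_min hex hj⟩
  refine hered τ (q i).1.2 _ ?_ ((q i).2.2.2.2 τ hi)
  rintro _ ⟨⟨j, rfl⟩, hj⟩
  refine hmem i j ?_
  rcases i with _ | k
  · exact Nat.zero_le _
  · have hk : n k ∈ τ := by
      by_contra hk
      refine hmin k (Nat.lt_succ_self k) fun m hm => ?_
      have := hi hm
      rw [hF, Finset.mem_insert] at this
      rcases this with rfl | h
      · exact absurd hm hk
      · exact h
    exact hn.lt_iff_lt.1 (hj _ hk)

/-- Nash-Williams' theorem: below `[σ,s]` one may pass to `[σ,s']` so that either every member of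
`[σ,s']`, or none of them, has an initial segment in the family `𝓕`. -/
theorem exists_nashWilliams (𝓕 : Set (Finset ℕ)) (σ : Finset ℕ) (s : Set ℕ) (hs : s.Infinite) :
    ∃ s' ⊆ s, s'.Infinite ∧ ((∀ a ∈ ES σ s', ∃ τ ∈ 𝓕, a ∈ ES τ Set.univ) ∨
      ∀ a ∈ ES σ s', ∀ τ ∈ 𝓕, a ∉ ES τ Set.univ) := by
  classical
  let acc : Finset ℕ → Set ℕ → Prop := fun τ s => ∀ a ∈ ES τ s, ∃ τ' ∈ 𝓕, a ∈ ES τ' Set.univ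
  let rej : Finset ℕ → Set ℕ → Prop := fun τ s => ∀ s' ⊆ s, s'.Infinite → ¬ acc τ s'
  have accH : ∀ τ s s', tailAbove τ s' ⊆ s → acc τ s → acc τ s' := fun τ s s' h ha a haa =>
    ha a (ES_subset_of_tailAbove h haa)
  have rejH : ∀ τ s s', tailAbove τ s' ⊆ s → rej τ s → rej τ s' := fun τ s s' h hr t ht hti hacc =>
    hr (tailAbove τ t) ((tailAbove_mono ht).trans h) (hti.tailAbove τ)
      (accH τ t _ ((tailAbove_subset _ _).trans (tailAbove_subset _ _)) hacc)
  obtain ⟨s₁, hs₁, hs₁i, h₁⟩ := exists_fusion (fun τ s => acc τ s ∨ rej τ s) σ s hs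
    (fun τ s s' h => Or.imp (accH τ s s' h) (rejH τ s s' h)) (by
      intro τ _ t _ hti
      by_cases h : ∃ t' ⊆ t, t'.Infinite ∧ acc τ t'
      · obtain ⟨t', h1, h2, h3⟩ := h
        exact ⟨t', h1, h2, Or.inl h3⟩
      · push Not at h
        exact ⟨t, subset_rfl, hti, Or.inr h⟩)
  rcases h₁ σ Set.subset_union_left with hacc | hrej
  · exact ⟨s₁, hs₁, hs₁i, Or.inl hacc⟩
  obtain ⟨s₂, hs₂, hs₂i, h₂⟩ := exists_fusion
    (fun τ s => acc τ s ∨ ∀ m ∈ s, (∀ k ∈ τ, k < m) → rej (insert m τ) s) σ s₁ hs₁i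
    (fun τ t t' h => Or.imp (accH τ t t' h) fun hr m hm hmτ =>
      rejH _ t t' ((tailAbove_anti _ (Finset.subset_insert _ _)).trans h)
        (hr m (h ⟨hm, hmτ⟩) hmτ)) (by
      intro τ hτ t ht hti
      let M := {m ∈ t | (∀ k ∈ τ, k < m) ∧ acc (insert m τ) s₁}
      by_cases hM : M.Infinite
      · refine ⟨M, fun _ h => h.1, hM, Or.inl fun a ha => ?_⟩
        obtain ⟨m, hm, -, ham⟩ := exists_mem_ES_insert ha
        exact hm.2.2 a (ES_mono _ (fun k (hk : k ∈ M) => ht hk.1) ham)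
      · refine ⟨t \ M, Set.sdiff_subset, hti.sdiff (Set.not_infinite.1 hM),
          Or.inr fun m hm hmτ => ?_⟩
        have hsub : ((insert m τ : Finset ℕ) : Set ℕ) ⊆ ↑σ ∪ s₁ := by
          rw [Finset.coe_insert]
          exact Set.insert_subset (Or.inr (ht hm.1)) hτ
        rcases h₁ _ hsub with h | h
        · exact absurd ⟨hm.1, hmτ, h⟩ hm.2
        · exact rejH _ _ _ ((tailAbove_subset _ _).trans (Set.sdiff_subset.trans ht)) h)
  refine ⟨s₂, hs₂.trans hs₁, hs₂i, Or.inr fun a ha τ' hτ' haτ' => ?_⟩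
  have key : ∀ N, ∃ τ : Finset ℕ, N ≤ τ.card ∧ (τ : Set ℕ) ⊆ ↑σ ∪ s₂ ∧ a ∈ ES τ s₂ ∧
      rej τ s₂ := by
    intro N
    induction N with
    | zero => exact ⟨σ, Nat.zero_le _, Set.subset_union_left, ha,
        rejH _ _ _ ((tailAbove_subset _ _).trans hs₂) hrej⟩
    | succ N ih =>
      obtain ⟨τ, h1, h2, h3, h4⟩ := ih
      obtain ⟨m, hm, hmτ, ham⟩ := exists_mem_ES_insert h3
      have hmem : m ∉ τ := fun hmem => lt_irrefl _ (hmτ m hmem)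
      refine ⟨insert m τ, by rw [Finset.card_insert_of_notMem hmem]; omega, ?_, ham, ?_⟩
      · rw [Finset.coe_insert]
        exact Set.insert_subset (Or.inr hm) h2
      · rcases h₂ τ h2 with h | h
        · exact absurd h (h4 s₂ subset_rfl hs₂i)
        · exact h m hm hmτ
  obtain ⟨τ, h1, -, h3, h4⟩ := key τ'.card
  have h3' := ES_mono τ (Set.subset_univ s₂) h3
  exact h4 s₂ subset_rfl hs₂i fun b hb => ⟨τ', hτ', mem_ES_of_initial h3' haτ'
    (subset_of_mem_ES_of_card_le h3' haτ' h1) (ES_mono τ (Set.subset_univ s₂) hb)⟩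

/-- `[τ,s]` meets `B`, and so does every `[τ,s']` with `s' ⊆ s` infinite. -/
def MeetsBelow (B : Set IOI) (τ : Finset ℕ) (s : Set ℕ) : Prop :=
  ∀ s' ⊆ s, s'.Infinite → (ES τ s' ∩ B).Nonempty

theorem MeetsBelow.of_tailAbove {B : Set IOI} {τ : Finset ℕ} {s s' : Set ℕ}
    (h : MeetsBelow B τ s) (hs : tailAbove τ s' ⊆ s) : MeetsBelow B τ s' := fun t ht hti =>
  (h _ ((tailAbove_mono ht).trans hs) (hti.tailAbove τ)).mono
    (Set.inter_subset_inter_left _ (ES_mono τ (tailAbove_subset τ t)))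

theorem RamseyPositive.exists_meetsBelow {B : Set IOI} (h : RamseyPositive B) :
    ∃ (σ : Finset ℕ) (s : Set ℕ), s.Infinite ∧ MeetsBelow B σ s := by
  simp only [RamseyPositive, RamseyNull] at h
  push Not at h
  obtain ⟨σ, s, ⟨hs, hlt⟩, h⟩ := h
  exact ⟨σ, s, hs, fun s' hs' hi =>
    h s' hs' hi fun m hm n hn => hlt m hm n (hs' hn)⟩

theorem exists_decided (B : List ℕ → Set IOI) (σ : Finset ℕ) (s : Set ℕ) (hs : s.Infinite) :
    ∃ s' ⊆ s, s'.Infinite ∧ ∀ τ : Finset ℕ, (τ : Set ℕ) ⊆ ↑σ ∪ s' → ∀ u : List ℕ,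
      Encodable.encode u ≤ τ.card → MeetsBelow (B u) τ s' ∨ Disjoint (ES τ s') (B u) := by
  let Q : Finset ℕ → List ℕ → Set ℕ → Prop := fun τ u s =>
    MeetsBelow (B u) τ s ∨ Disjoint (ES τ s) (B u)
  have hQ : ∀ τ u s s', tailAbove τ s' ⊆ s → Q τ u s → Q τ u s' := fun τ u s s' h =>
    Or.imp (fun h' => h'.of_tailAbove h) fun h' => h'.mono_left (ES_subset_of_tailAbove h)
  refine exists_fusion (fun τ s => ∀ u : List ℕ, Encodable.encode u ≤ τ.card → Q τ u s) σ s hs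
    (fun τ s s' h hP u hu => hQ τ u s s' h (hP u hu)) fun τ _ t ht hti => ?_
  have hfin : {u : List ℕ | Encodable.encode u ≤ τ.card}.Finite :=
    (Set.finite_Iic τ.card).preimage Encodable.encode_injective.injOn
  obtain ⟨t', h1, h2, h3⟩ := exists_infinite_subset_forall_finset (Q τ) s
    (fun u s s' h => hQ τ u s s' ((tailAbove_subset _ _).trans h)) hfin.toFinset (by
      intro u _ t _ hti
      by_cases h : MeetsBelow (B u) τ t
      · exact ⟨t, subset_rfl, hti, Or.inl h⟩
      · simp only [MeetsBelow] at h
        push Not at h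
        obtain ⟨t', h1, h2, h3⟩ := h
        exact ⟨t', h1, h2, Or.inr (Set.disjoint_iff_inter_eq_empty.2 h3)⟩) t ht hti
  exact ⟨t', h1, h2, fun u hu => h3 u (hfin.mem_toFinset.2 hu)⟩

/-- If `B u ⊆ ⋃ n, B (n :: u)` for all `u`, then after shrinking `s` hereditary meeting propagates
from `B u` to some `B (n :: u)` along every element of the Ellentuck set. -/
theorem exists_propagating (B : List ℕ → Set IOI) (hB : ∀ u, B u ⊆ ⋃ n, B (n :: u))
    (σ : Finset ℕ) (s : Set ℕ) (hs : s.Infinite) :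
    ∃ s' ⊆ s, s'.Infinite ∧ ∀ τ : Finset ℕ, (τ : Set ℕ) ⊆ ↑σ ∪ s' → ∀ u : List ℕ,
      Encodable.encode u ≤ τ.card → MeetsBelow (B u) τ s' → ∀ a ∈ ES τ s',
        ∃ (n : ℕ) (τ' : Finset ℕ), (τ' : Set ℕ) ⊆ ↑σ ∪ s' ∧
          Encodable.encode (n :: u) ≤ τ'.card ∧ MeetsBelow (B (n :: u)) τ' s' ∧
          a ∈ ES τ' s' := by
  obtain ⟨s₁, hs₁, hs₁i, h₁⟩ := exists_decided B σ s hs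
  let R : Finset ℕ → List ℕ → Set ℕ → Prop := fun τ u s =>
    Disjoint (ES τ s) (B u) ∨ ∀ a ∈ ES τ s, ∃ (n : ℕ) (τ' : Finset ℕ), τ ⊆ τ' ∧
      Encodable.encode (n :: u) ≤ τ'.card ∧ MeetsBelow (B (n :: u)) τ' s ∧ a ∈ ES τ' Set.univ
  have hR : ∀ τ u s s', tailAbove τ s' ⊆ s → R τ u s → R τ u s' := fun τ u s s' h =>
    Or.imp (fun h' => h'.mono_left (ES_subset_of_tailAbove h)) fun h' a ha => by
      obtain ⟨n, τ', h1, h2, h3, h4⟩ := h' a (ES_subset_of_tailAbove h ha)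
      exact ⟨n, τ', h1, h2, h3.of_tailAbove ((tailAbove_anti _ h1).trans h), h4⟩
  obtain ⟨s₂, hs₂, hs₂i, h₂⟩ := exists_fusion
    (fun τ s => ∀ u : List ℕ, Encodable.encode u ≤ τ.card → R τ u s) σ s₁ hs₁i
    (fun τ s s' h hP u hu => hR τ u s s' h (hP u hu)) (by
      intro τ hτ t ht hti
      have hfin : {u : List ℕ | Encodable.encode u ≤ τ.card}.Finite :=
        (Set.finite_Iic τ.card).preimage Encodable.encode_injective.injOn
      obtain ⟨t', h1, h2, h3⟩ := exists_infinite_subset_forall_finset (R τ) s₁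
        (fun u s s' h => hR τ u s s' ((tailAbove_subset _ _).trans h)) hfin.toFinset (by
          intro u _ t ht hti
          obtain ⟨t', h1, h2, h3⟩ := exists_nashWilliams {τ' | τ ⊆ τ' ∧ ∃ n,
            Encodable.encode (n :: u) ≤ τ'.card ∧ MeetsBelow (B (n :: u)) τ' s₁} τ t hti
          refine ⟨t', h1, h2, ?_⟩
          rcases h3 with h3 | h3
          · refine Or.inr fun a ha => ?_
            obtain ⟨τ', ⟨h4, n, h5, h6⟩, h7⟩ := h3 a ha
            exact ⟨n, τ', h4, h5, h6.of_tailAbove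
              ((tailAbove_subset _ _).trans (h1.trans ht)), h7⟩
          · refine Or.inl (Set.disjoint_left.2 fun a ha hau => ?_)
            obtain ⟨n, hn⟩ := Set.mem_iUnion.1 (hB u hau)
            obtain ⟨τ', h4, h5, h6⟩ := exists_card_le_mem_ES ha (Encodable.encode (n :: u))
            have h7 := ES_mono τ' (Set.subset_univ t') h6
            have h8 : (τ' : Set ℕ) ⊆ ↑σ ∪ s₁ := (coe_subset_of_mem_ES ha h7).trans
              (Set.union_subset hτ ((h1.trans ht).trans Set.subset_union_right))
            rcases h₁ τ' h8 _ h5 with h9 | h9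
            · exact h3 a ha τ' ⟨h4, n, h5, h9⟩ h7
            · exact Set.disjoint_left.1 h9 (ES_mono τ' (h1.trans ht) h6) hn) t ht hti
      exact ⟨t', h1, h2, fun u hu => h3 u (hfin.mem_toFinset.2 hu)⟩)
  refine ⟨s₂, hs₂.trans hs₁, hs₂i, fun τ hτ u hu hm a ha => ?_⟩
  rcases h₂ τ hτ u hu with h | h
  · exact absurd (Set.disjoint_iff_inter_eq_empty.1 h) (hm s₂ subset_rfl hs₂i).ne_empty
  · obtain ⟨n, τ', h1, h2, h3, h4⟩ := h a ha
    exact ⟨n, τ', (coe_subset_of_mem_ES ha h4).trans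
      (Set.union_subset hτ Set.subset_union_right), h2, h3, mem_ES_of_subset ha h4 h1⟩

/-- Membership in the Ellentuck set `[σ,{n | t n}]`, as a condition on characteristic functions. -/
def InES (σ : Finset ℕ) (t a : ℕ → Bool) : Prop :=
  (∀ m ∈ σ, a m = true) ∧ ∀ n, a n = true → n ∉ σ → t n = true ∧ ∀ m ∈ σ, m < n

/-- `(t, D)` witnesses that the section at `x` of the range of `f` is Ramsey positive. The set `D`
lists pairs `(τ, u)` such that `[τ,t]` is handled by parameters extending the (reversed) list
`u`. -/
structure IsWitness (f : (ℕ → ℕ) → (ℕ → Bool) × IOI) (x t : ℕ → Bool)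
    (D : Finset ℕ × List ℕ → Bool) : Prop where
  infinite : ∀ N, ∃ n, N < n ∧ t n = true
  root : ∃ σ, D (σ, []) = true
  approx : ∀ p : Finset ℕ × List ℕ, D p = true → p.2.length ≤ p.1.card ∧
    ∃ y, PiNat.res y p.2.length = p.2 ∧ (∀ i < p.2.length, (f y).1 i = x i) ∧
      (f y).2 ∈ ES p.1 Set.univ
  propagate : ∀ p : Finset ℕ × List ℕ, D p = true → ∀ a : ℕ → Bool,
    (∀ N, ∃ n, N < n ∧ a n = true) → InES p.1 t a →
      ∃ (n : ℕ) (τ' : Finset ℕ), D (τ', n :: p.2) = true ∧ InES τ' t a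

theorem infinite_iff_forall_exists_true {t : ℕ → Bool} :
    {n | t n = true}.Infinite ↔ ∀ N, ∃ n, N < n ∧ t n = true :=
  ⟨fun h N => (h.exists_gt N).imp fun _ hn => ⟨hn.2, hn.1⟩,
    fun h => Set.infinite_of_forall_exists_gt fun N => (h N).imp fun _ hn => ⟨hn.2, hn.1⟩⟩

theorem exists_isWitness {f : (ℕ → ℕ) → (ℕ → Bool) × IOI} {x : ℕ → Bool}
    (h : RamseyPositive {a : IOI | (x, a) ∈ Set.range f}) : ∃ t D, IsWitness f x t D := by
  classical
  obtain ⟨σ, s, hs, hm⟩ := h.exists_meetsBelow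
  let B : List ℕ → Set IOI := fun u => {a | ∃ y, PiNat.res y u.length = u ∧ f y = (x, a)}
  have hB : ∀ u, B u ⊆ ⋃ n, B (n :: u) := by
    rintro u a ⟨y, hy, hya⟩
    refine Set.mem_iUnion.2 ⟨y u.length, y, ?_, hya⟩
    rw [List.length_cons, PiNat.res_succ, hy]
  obtain ⟨s', hs', hi, hp⟩ := exists_propagating B hB σ s hs
  have h0 : MeetsBelow (B []) σ s' := fun t ht hti => by
    obtain ⟨a, ha, y, hy⟩ := hm t (ht.trans hs') hti
    exact ⟨a, ha, y, rfl, hy⟩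
  refine ⟨fun n => decide (n ∈ s'), fun p => decide ((p.1 : Set ℕ) ⊆ ↑σ ∪ s' ∧
    Encodable.encode p.2 ≤ p.1.card ∧ MeetsBelow (B p.2) p.1 s'), ?_, ⟨σ, ?_⟩, ?_, ?_⟩
  · exact infinite_iff_forall_exists_true.1 (by simpa using hi)
  · simpa using h0
  · rintro ⟨τ, u⟩ hD
    obtain ⟨-, h2, h3⟩ := of_decide_eq_true hD
    refine ⟨(Encodable.length_le_encode u).trans h2, ?_⟩
    obtain ⟨a, ha, y, hy, hya⟩ := h3 s' subset_rfl hi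
    exact ⟨y, hy, fun i _ => by rw [hya], by rw [hya]; exact ES_mono τ (Set.subset_univ _) ha⟩
  · rintro ⟨τ, u⟩ hD a ha hat
    obtain ⟨h1, h2, h3⟩ := of_decide_eq_true hD
    obtain ⟨n, τ', h4, h5, h6, h7⟩ := hp τ h1 u h2 h3
      ⟨a, infinite_iff_forall_exists_true.2 ha⟩
      ⟨hat.1, fun n hn hnτ => ⟨of_decide_eq_true (hat.2 n hn hnτ).1, (hat.2 n hn hnτ).2⟩⟩
    exact ⟨n, τ', decide_eq_true ⟨h4, h5, h6⟩, h7.1,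
      fun n hn hnτ => ⟨decide_eq_true (h7.2 n hn hnτ).1, (h7.2 n hn hnτ).2⟩⟩

theorem eq_of_mem_ES_of_lt_card {τ : Finset ℕ} {a b : IOI} (ha : a ∈ ES τ Set.univ)
    (hb : b ∈ ES τ Set.univ) {k : ℕ} (hk : k < τ.card) : a.1 k = b.1 k := by
  by_cases hkτ : k ∈ τ
  · rw [ha.1 k hkτ, hb.1 k hkτ]
  · have key : ∀ c : IOI, c ∈ ES τ Set.univ → c.1 k = false := fun c hc => by
      by_contra hck
      have h1 : τ ⊆ Finset.range k := fun m hm =>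
        Finset.mem_range.2 ((hc.2 k (by simpa using hck) hkτ).2 m hm)
      have := Finset.card_le_card h1
      rw [Finset.card_range] at this
      omega
    rw [key a ha, key b hb]

theorem IsWitness.exists_forall_mem {f : (ℕ → ℕ) → (ℕ → Bool) × IOI} (hf : Continuous f)
    {x t : ℕ → Bool} {D : Finset ℕ × List ℕ → Bool} (h : IsWitness f x t D) :
    ∃ σ, ∀ a ∈ ES σ {n | t n = true}, (x, a) ∈ Set.range f := by
  obtain ⟨σ, hσ⟩ := h.root
  refine ⟨σ, fun a ha => ?_⟩
  let S := {p : Finset ℕ × List ℕ // D p = true ∧ a ∈ ES p.1 {n | t n = true}}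
  have step : ∀ p : S, ∃ (q : S) (n : ℕ), q.1.2 = n :: p.1.2 := by
    rintro ⟨⟨τ, u⟩, hD, hp⟩
    obtain ⟨n, τ', h1, h2⟩ := h.propagate _ hD a.1 (infinite_iff_forall_exists_true.1 a.2) hp
    exact ⟨⟨⟨τ', n :: u⟩, h1, h2⟩, n, rfl⟩
  choose next elt hnext using step
  let q : ℕ → S := fun i => next^[i] ⟨⟨σ, []⟩, hσ, ha⟩
  have hq : ∀ i, q (i + 1) = next (q i) := fun i => Function.iterate_succ_apply' _ _ _
  let y : ℕ → ℕ := fun i => elt (q i)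
  have hy : ∀ i, (q i).1.2 = PiNat.res y i := by
    intro i
    induction i with
    | zero => rfl
    | succ i ih => rw [hq, hnext, PiNat.res_succ, ih]
  have happ : ∀ i, ∃ z, PiNat.res z i = PiNat.res y i ∧ (∀ j < i, (f z).1 j = x j) ∧
      ∀ j < i, (f z).2.1 j = a.1 j := by
    intro i
    obtain ⟨h1, z, h2, h3, h4⟩ := h.approx _ (q i).2.1
    rw [hy, PiNat.res_length] at h1 h2 h3
    exact ⟨z, h2, h3, fun j hj => eq_of_mem_ES_of_lt_card h4
      (ES_mono _ (Set.subset_univ _) (q i).2.2) (hj.trans_le h1)⟩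
  choose z hz1 hz2 hz3 using happ
  have hz : Filter.Tendsto z Filter.atTop (nhds y) := by
    refine tendsto_pi_nhds.2 fun j => tendsto_const_nhds.congr' ?_
    filter_upwards [Filter.eventually_gt_atTop j] with i hi
    exact (PiNat.res_eq_res.1 (hz1 i) hi).symm
  have hfz := (hf.tendsto y).comp hz
  refine ⟨y, Prod.ext ?_ (Subtype.ext ?_)⟩
  · refine tendsto_nhds_unique ((continuous_fst.tendsto _).comp hfz)
      (tendsto_pi_nhds.2 fun j => tendsto_const_nhds.congr' ?_)
    filter_upwards [Filter.eventually_gt_atTop j] with i hi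
    exact (hz2 i j hi).symm
  · refine tendsto_nhds_unique
      (((continuous_subtype_val.comp continuous_snd).tendsto _).comp hfz)
      (tendsto_pi_nhds.2 fun j => tendsto_const_nhds.congr' ?_)
    filter_upwards [Filter.eventually_gt_atTop j] with i hi
    exact (hz3 i j hi).symm

theorem ES_nonempty (σ : Finset ℕ) {s : Set ℕ} (hs : s.Infinite) : (ES σ s).Nonempty := by
  classical
  refine ⟨⟨fun n => decide (n ∈ (σ : Set ℕ) ∪ tailAbove σ s), ?_⟩, fun m hm => ?_,
    fun n hn hnσ => ?_⟩
  · exact (hs.tailAbove σ).mono fun n hn => decide_eq_true (Or.inr hn)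
  · exact decide_eq_true (Or.inl hm)
  · exact (of_decide_eq_true hn).resolve_left hnσ

theorem IsWitness.ramseyPositive {f : (ℕ → ℕ) → (ℕ → Bool) × IOI} (hf : Continuous f)
    {x t : ℕ → Bool} {D : Finset ℕ × List ℕ → Bool} (h : IsWitness f x t D) :
    RamseyPositive {a : IOI | (x, a) ∈ Set.range f} := by
  intro hnull
  obtain ⟨σ, hσ⟩ := h.exists_forall_mem hf
  obtain ⟨s', h1, h2, -, h4⟩ := hnull σ (tailAbove σ {n | t n = true})
    ⟨(infinite_iff_forall_exists_true.2 h.infinite).tailAbove σ, fun m hm n hn => hn.2 m hm⟩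
  obtain ⟨a, ha⟩ := ES_nonempty σ h2
  have : a ∈ (∅ : Set IOI) :=
    h4 ▸ ⟨ha, hσ a (ES_mono σ (h1.trans (tailAbove_subset _ _)) ha)⟩
  exact this

theorem measurable_eq_true {Z : Type*} [MeasurableSpace Z] {g : Z → Bool} (hg : Measurable g) :
    Measurable fun z => g z = true :=
  measurableSet_setOfPred.1 (hg (measurableSet_singleton true))

theorem Measurable.inES {Z : Type*} [MeasurableSpace Z] (σ : Finset ℕ) {t a : Z → ℕ → Bool}
    (ht : Measurable t) (ha : Measurable a) : Measurable fun z => InES σ (t z) (a z) := by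
  have ha' : ∀ n, Measurable fun z => a z n = true := fun n =>
    measurable_eq_true ((measurable_pi_apply n).comp ha)
  have ht' : ∀ n, Measurable fun z => t z n = true := fun n =>
    measurable_eq_true ((measurable_pi_apply n).comp ht)
  exact (Measurable.forall fun m => (measurable_const).imp (ha' m)).and
    (Measurable.forall fun n => (ha' n).imp (measurable_const.imp ((ht' n).and measurable_const)))

theorem Measurable.frequentlyTrue {Z : Type*} [MeasurableSpace Z] {a : Z → ℕ → Bool}
    (ha : Measurable a) : Measurable fun z => ∀ N, ∃ n, N < n ∧ a z n = true :=
  Measurable.forall fun _ => Measurable.exists fun n =>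
    measurable_const.and (measurable_eq_true ((measurable_pi_apply n).comp ha))

/-- The space of triples `(x, t, D)` to which `IsWitness` applies. -/
abbrev WitnessSpace := (ℕ → Bool) × (ℕ → Bool) × (Finset ℕ × List ℕ → Bool)

instance : PolishSpace WitnessSpace where

instance : PolishSpace (WitnessSpace × (ℕ → Bool)) where

theorem analyticSet_compl_isWitness (f : (ℕ → ℕ) → (ℕ → Bool) × IOI) :
    AnalyticSet {z : WitnessSpace | IsWitness f z.1 z.2.1 z.2.2}ᶜ := by
  have hx : ∀ i, Measurable fun z : WitnessSpace => z.1 i := fun i =>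
    (measurable_pi_apply i).comp measurable_fst
  have hD : ∀ p, Measurable fun z : WitnessSpace => z.2.2 p = true := fun p =>
    measurable_eq_true ((measurable_pi_apply p).comp (measurable_snd.comp measurable_snd))
  have hopen : ∀ p : Finset ℕ × List ℕ, Measurable fun z : WitnessSpace => ∃ y,
      PiNat.res y p.2.length = p.2 ∧ (∀ i < p.2.length, (f y).1 i = z.1 i) ∧
        (f y).2 ∈ ES p.1 Set.univ := by
    intro p
    have : IsOpen {z : WitnessSpace | ∃ y, PiNat.res y p.2.length = p.2 ∧
        (∀ i < p.2.length, (f y).1 i = z.1 i) ∧ (f y).2 ∈ ES p.1 Set.univ} := by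
      rw [Set.ofPred_exists]
      refine isOpen_iUnion fun y => isOpen_const.and (IsOpen.and ?_ isOpen_const)
      have : {z : WitnessSpace | ∀ i < p.2.length, (f y).1 i = z.1 i} =
          ⋂ i ∈ Set.Iio p.2.length, (fun z : WitnessSpace => z.1 i) ⁻¹' {(f y).1 i} := by
        ext z; simp [eq_comm]
      rw [this]
      exact (Set.finite_Iio _).isOpen_biInter fun i _ =>
        (isOpen_discrete _).preimage (by fun_prop)
    exact measurableSet_setOfPred.1 this.measurableSet
  let G : WitnessSpace → Prop := fun z => (∀ N, ∃ n, N < n ∧ z.2.1 n = true) ∧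
    (∃ σ, z.2.2 (σ, []) = true) ∧
    ∀ p : Finset ℕ × List ℕ, z.2.2 p = true → p.2.length ≤ p.1.card ∧
      ∃ y, PiNat.res y p.2.length = p.2 ∧ (∀ i < p.2.length, (f y).1 i = z.1 i) ∧
        (f y).2 ∈ ES p.1 Set.univ
  have hG : Measurable G :=
    (Measurable.frequentlyTrue (measurable_fst.comp measurable_snd)).and
      ((Measurable.exists fun σ => hD (σ, [])).and
        (Measurable.forall fun p => (hD p).imp (measurable_const.and (hopen p))))
  let bad : Finset ℕ × List ℕ → WitnessSpace × (ℕ → Bool) → Prop := fun p w =>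
    w.1.2.2 p = true ∧ (∀ N, ∃ n, N < n ∧ w.2 n = true) ∧ InES p.1 w.1.2.1 w.2 ∧
      ¬ ∃ (n : ℕ) (τ' : Finset ℕ), w.1.2.2 (τ', n :: p.2) = true ∧ InES τ' w.1.2.1 w.2
  have hES : ∀ τ, Measurable fun w : WitnessSpace × (ℕ → Bool) => InES τ w.1.2.1 w.2 := fun τ =>
    Measurable.inES τ (measurable_fst.comp (measurable_snd.comp measurable_fst)) measurable_snd
  have hbad : ∀ p, Measurable (bad p) := fun p =>
    ((hD p).comp measurable_fst).and ((Measurable.frequentlyTrue measurable_snd).and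
      ((hES p.1).and (Measurable.not (Measurable.exists fun n => Measurable.exists fun τ' =>
        ((hD (τ', n :: p.2)).comp measurable_fst).and (hES τ')))))
  have heq : {z : WitnessSpace | IsWitness f z.1 z.2.1 z.2.2}ᶜ =
      ⋃ o : Option (Finset ℕ × List ℕ), o.elim {z | ¬ G z} fun p => Prod.fst '' {w | bad p w} := by
    ext z
    simp only [Set.mem_compl_iff, Set.mem_ofPred_eq, Set.mem_iUnion, Option.exists, Option.elim,
      Set.mem_image]
    constructor
    · intro hz
      by_contra! hcon
      refine hz ⟨hcon.1.1, hcon.1.2.1, hcon.1.2.2, ?_⟩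
      rintro ⟨τ, u⟩ hp a ha hat
      by_contra hne
      exact hcon.2 (τ, u) (z, a) ⟨hp, ha, hat, hne⟩ rfl
    · rintro (hz | ⟨p, ⟨z', a⟩, ⟨h1, h2, h3, h4⟩, rfl⟩) hw
      · exact hz ⟨hw.infinite, hw.root, hw.approx⟩
      · exact h4 (hw.propagate _ h1 a h2 h3)
  rw [heq]
  refine AnalyticSet.iUnion fun o => ?_
  rcases o with _ | p
  · exact (measurableSet_setOfPred.2 hG.not).analyticSet
  · exact (measurableSet_setOfPred.2 (hbad p)).analyticSet.image_of_continuous continuous_fst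

/-- For every analytic `A ⊆ 2^ℕ × [ω]^ω`, the set of `x` whose section `A_x` is
Ramsey positive is `Σ¹₂`. -/
theorem statement1 (A : Set ((ℕ → Bool) × IOI)) (hA : AnalyticSet A) :
    Sigma12 {x : ℕ → Bool | RamseyPositive {a : IOI | (x, a) ∈ A}} := by
  rw [AnalyticSet] at hA
  rcases hA with rfl | ⟨f, hf, rfl⟩
  · refine ⟨∅, fun _ _ => true, ?_, continuous_const, ?_⟩
    · rw [Set.compl_empty]
      exact isClosed_univ.analyticSet
    · rw [Set.image_empty, eq_comm, Set.eq_empty_iff_forall_notMem]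
      intro x hx
      obtain ⟨σ, s, hs, h⟩ := RamseyPositive.exists_meetsBelow hx
      obtain ⟨a, -, ha⟩ := h s subset_rfl hs
      exact ha
  · obtain ⟨g, hg, hgs⟩ := PolishSpace.exists_nat_nat_continuous_surjective WitnessSpace
    refine ⟨g ⁻¹' {z | IsWitness f z.1 z.2.1 z.2.2}, fun y => (g y).1, ?_,
      continuous_fst.comp hg, ?_⟩
    · rw [← Set.preimage_compl]
      exact (analyticSet_compl_isWitness f).preimage hg
    · ext x
      constructor
      · rintro ⟨y, hy, rfl⟩
        exact IsWitness.ramseyPositive hf hy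
      · intro hx
        obtain ⟨t, D, h⟩ := exists_isWitness hx
        obtain ⟨y, hy⟩ := hgs (x, t, D)
        refine ⟨y, ?_, ?_⟩
        · rw [Set.mem_preimage, hy]
          exact h
        · simp only [hy]
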